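/- For every integer n ≥ 1, the number of Schröder paths of length 2n having no peak of odd height equals the number of Schröder paths of length 2n whose first step is U and which have no peak of even height. -/

import Mathlib

/-- Steps of a Schröder path: `U = (1,1)`, `D = (1,-1)`, `H = H² = (2,0)`. -/
inductive SStep : Type
  | U : SStep
  | D : SStep
  | H : SStep
  deriving DecidableEq

/-- The contribution of a step to the x-coordinate. -/
def SStep.len : SStep → ℕ
  | U => 1
  | D => 1
  | H => 2

/-- The contribution of a step to the y-coordinate. -/
def SStep.eff : SStep → ℤ
  | U => 1
  | D => -1
  | H => 0

/-- The height (y-coordinate of the starting point) of the `i`-th step (0-indexed);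
for `i = L.length` this is the final height of the path. -/
def sHeight (L : List SStep) (i : ℕ) : ℤ := ((L.take i).map SStep.eff).sum

/-- `L` is a Schröder path of length `2 * n`: it has total horizontal displacement `2 * n`,
ends at height `0`, and never goes below the x-axis. -/
def IsSchroder (L : List SStep) (n : ℕ) : Prop :=
  (L.map SStep.len).sum = 2 * n ∧ (L.map SStep.eff).sum = 0 ∧ ∀ i, 0 ≤ sHeight L i

/-- A peak at position `i`: an up step immediately followed by a down step.
The height of this peak is `sHeight L (i+1)`, the height of its down step. -/
def IsPeakAt (L : List SStep) (i : ℕ) : Prop :=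
  L[i]? = some SStep.U ∧ L[i+1]? = some SStep.D

/-- `L` has no peak of odd height. -/
def NoOddPeak (L : List SStep) : Prop :=
  ∀ i, IsPeakAt L i → ¬ Odd (sHeight L (i+1))

/-- `L` has no peak of even height. -/
def NoEvenPeak (L : List SStep) : Prop :=
  ∀ i, IsPeakAt L i → ¬ Even (sHeight L (i+1))

/-- `L` is UH-free: no up step is immediately followed by a horizontal step. -/
def UHFree (L : List SStep) : Prop :=
  ∀ i, ¬ (L[i]? = some SStep.U ∧ L[i+1]? = some SStep.H)

/-- The number of peaks of `L` of even height greater than `2`. -/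
def evenHighPeaks (L : List SStep) : ℕ :=
  ((Finset.range L.length).filter
    (fun i => L[i]? = some SStep.U ∧ L[i+1]? = some SStep.D ∧
      Even (sHeight L (i+1)) ∧ 2 < sHeight L (i+1))).card

/-- The final height of the path `L` started at height `0`. -/
def endHeight (L : List SStep) : ℤ := (L.map SStep.eff).sum

/-- The total horizontal displacement of `L`. -/
def pathLength (L : List SStep) : ℕ := (L.map SStep.len).sum

/-- The path `L` started at height `h` never goes below the x-axis. -/
def StaysNonneg : ℤ → List SStep → Prop
  | h, [] => 0 ≤ h
  | h, s :: L => 0 ≤ h ∧ StaysNonneg (h + s.eff) L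

/-- The path `L` started at height `h` has no peak whose height satisfies `q`. -/
def NoPeak (q : ℤ → Prop) : ℤ → List SStep → Prop
  | _, [] => True
  | h, s :: L => (s = SStep.U → L.head? = some SStep.D → ¬ q (h + 1)) ∧ NoPeak q (h + s.eff) L

@[simp] lemma endHeight_nil : endHeight [] = 0 := rfl

@[simp] lemma endHeight_cons (s : SStep) (L : List SStep) :
    endHeight (s :: L) = s.eff + endHeight L := by
  simp [endHeight]

@[simp] lemma endHeight_append (A B : List SStep) :
    endHeight (A ++ B) = endHeight A + endHeight B := by
  simp [endHeight]

@[simp] lemma pathLength_nil : pathLength [] = 0 := rfl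

@[simp] lemma pathLength_cons (s : SStep) (L : List SStep) :
    pathLength (s :: L) = s.len + pathLength L := by
  simp [pathLength]

@[simp] lemma pathLength_append (A B : List SStep) :
    pathLength (A ++ B) = pathLength A + pathLength B := by
  simp [pathLength]

@[simp] lemma sHeight_zero (L : List SStep) : sHeight L 0 = 0 := by simp [sHeight]

@[simp] lemma sHeight_cons_succ (s : SStep) (L : List SStep) (i : ℕ) :
    sHeight (s :: L) (i + 1) = s.eff + sHeight L i := by
  simp [sHeight]

lemma staysNonneg_iff (L : List SStep) (h : ℤ) :
    StaysNonneg h L ↔ ∀ i, 0 ≤ h + sHeight L i := by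
  induction L generalizing h with
  | nil => simp [StaysNonneg, sHeight]
  | cons s L ih =>
    rw [StaysNonneg, ih]
    constructor
    · rintro ⟨h0, h1⟩ (_ | i)
      · simpa using h0
      · simpa [add_assoc] using h1 i
    · intro H
      exact ⟨by simpa using H 0, fun i => by simpa [add_assoc] using H (i + 1)⟩

lemma noPeak_iff (q : ℤ → Prop) (L : List SStep) (h : ℤ) :
    NoPeak q h L ↔ ∀ i, IsPeakAt L i → ¬ q (h + sHeight L (i + 1)) := by
  induction L generalizing h with
  | nil => simp [NoPeak, IsPeakAt]
  | cons s L ih =>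
    rw [NoPeak, ih]
    constructor
    · rintro ⟨h0, h1⟩ (_ | i) ⟨hU, hD⟩
      · obtain rfl : s = SStep.U := by simpa using hU
        simpa [SStep.eff] using h0 rfl (by simpa [List.head?_eq_getElem?] using hD)
      · have := h1 i ⟨by simpa using hU, by simpa using hD⟩
        simpa [add_assoc] using this
    · intro H
      refine ⟨?_, fun i hi => ?_⟩
      · rintro rfl hD
        simpa [SStep.eff] using
          H 0 ⟨by simp, by simpa [List.head?_eq_getElem?] using hD⟩
      · simpa [add_assoc] using
          H (i + 1) ⟨by simpa using hi.1, by simpa using hi.2⟩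

lemma isSchroder_iff (L : List SStep) (n : ℕ) :
    IsSchroder L n ↔ pathLength L = 2 * n ∧ endHeight L = 0 ∧ StaysNonneg 0 L := by
  simp [IsSchroder, staysNonneg_iff, pathLength, endHeight]

lemma noOddPeak_iff (L : List SStep) : NoOddPeak L ↔ NoPeak Odd 0 L := by
  simp [NoOddPeak, noPeak_iff]

lemma noEvenPeak_iff (L : List SStep) : NoEvenPeak L ↔ NoPeak Even 0 L := by
  simp [NoEvenPeak, noPeak_iff]

lemma StaysNonneg.nonneg {h : ℤ} {L : List SStep} (H : StaysNonneg h L) : 0 ≤ h := by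
  cases L with
  | nil => exact H
  | cons s L => exact H.1

lemma StaysNonneg.mono {h k : ℤ} {L : List SStep} (H : StaysNonneg h L) (hk : h ≤ k) :
    StaysNonneg k L := by
  rw [staysNonneg_iff] at H ⊢
  intro i
  linarith [H i]

lemma staysNonneg_append (A B : List SStep) (h : ℤ) :
    StaysNonneg h (A ++ B) ↔ StaysNonneg h A ∧ StaysNonneg (h + endHeight A) B := by
  induction A generalizing h with
  | nil => simpa [StaysNonneg] using fun H : StaysNonneg h B => H.nonneg
  | cons s A ih => simp [StaysNonneg, ih, and_assoc, add_assoc]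

lemma noPeak_append (q : ℤ → Prop) (A B : List SStep) (h : ℤ) :
    NoPeak q h (A ++ B) ↔ NoPeak q h A ∧ NoPeak q (h + endHeight A) B ∧
      (A.getLast? = some SStep.U → B.head? = some SStep.D → ¬ q (h + endHeight A)) := by
  induction A generalizing h with
  | nil => simp [NoPeak]
  | cons s A ih =>
    cases A with
    | nil =>
      cases s <;> simp [NoPeak, SStep.eff, and_comm]
    | cons t A =>
      have := ih (h + s.eff)
      rw [List.cons_append, NoPeak, this, NoPeak.eq_2 q h s (t :: A), List.getLast?_cons_cons]
      simp [add_assoc, and_assoc]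

lemma noPeak_congr {q r : ℤ → Prop} (c : ℤ) (hqr : ∀ x, q (x + c) ↔ r x) (h : ℤ)
    (L : List SStep) : NoPeak q (h + c) L ↔ NoPeak r h L := by
  simp only [noPeak_iff, ← hqr, add_right_comm]

lemma noPeak_odd_one (L : List SStep) : NoPeak Odd 1 L ↔ NoPeak Even 0 L :=
  noPeak_congr (q := Odd) (r := Even) 1 (fun x => by grind) 0 L

lemma noPeak_even_one (L : List SStep) : NoPeak Even 1 L ↔ NoPeak Odd 0 L :=
  noPeak_congr (q := Even) (r := Odd) 1 (fun x => by grind) 0 L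

lemma StaysNonneg.getLast?_ne_U {L : List SStep} (H : StaysNonneg 0 L) (h0 : endHeight L = 0) :
    L.getLast? ≠ some SStep.U := by
  intro hU
  obtain ⟨A, rfl⟩ := List.getLast?_eq_some_iff.1 hU
  have := ((staysNonneg_append _ _ _).1 H).2.nonneg
  simp [SStep.eff] at h0
  omega

lemma noPeak_arch (q : ℤ → Prop) {P : List SStep} (Q : List SStep) (hP : StaysNonneg 0 P)
    (h0 : endHeight P = 0) :
    NoPeak q 0 (SStep.U :: (P ++ SStep.D :: Q)) ↔
      (P = [] → ¬ q 1) ∧ NoPeak q 1 P ∧ NoPeak q 0 Q := by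
  have hU := hP.getLast?_ne_U h0
  have hhead : P.head? = some SStep.D → False := by
    cases P with
    | nil => simp
    | cons s P =>
      rintro h
      obtain rfl : s = SStep.D := by simpa using h
      simpa [SStep.eff] using hP.2.nonneg
  rw [NoPeak, noPeak_append]
  cases P with
  | nil => simp [NoPeak, SStep.eff, h0]
  | cons s P =>
    have hs : s ≠ SStep.D := by simpa using hhead
    simp [NoPeak, SStep.eff, h0, hU, hs]

lemma staysNonneg_arch {P Q : List SStep} (hP : StaysNonneg 0 P) (h0 : endHeight P = 0)
    (hQ : StaysNonneg 0 Q) : StaysNonneg 0 (SStep.U :: (P ++ SStep.D :: Q)) := by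
  have := hP.mono zero_le_one
  simp [StaysNonneg, staysNonneg_append, SStep.eff, h0, hQ, this]

lemma exists_first_descent (L : List SStep) (h : ℤ) (h1 : 0 ≤ h) (hL : h + 1 + endHeight L ≤ 0) :
    ∃ P Q, L = P ++ SStep.D :: Q ∧ StaysNonneg h P ∧ h + endHeight P = 0 := by
  induction L generalizing h with
  | nil => simp at hL; omega
  | cons s L ih =>
    by_cases hs : 0 ≤ h + s.eff
    · obtain ⟨P, Q, rfl, hP, hP0⟩ := ih (h + s.eff) hs (by simp at hL; linarith)
      exact ⟨s :: P, Q, rfl, ⟨h1, hP⟩, by simp; linarith⟩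
    · cases s with
      | D => exact ⟨[], L, rfl, h1, by simp [SStep.eff] at hs ⊢; omega⟩
      | U => simp [SStep.eff] at hs; omega
      | H => simp [SStep.eff] at hs; omega

lemma exists_arch {L : List SStep} (hL : StaysNonneg 0 (SStep.U :: L))
    (h0 : endHeight (SStep.U :: L) = 0) :
    ∃ P Q, L = P ++ SStep.D :: Q ∧ (StaysNonneg 0 P ∧ endHeight P = 0) ∧
      StaysNonneg 0 Q ∧ endHeight Q = 0 := by
  obtain ⟨P, Q, rfl, hP, hP0⟩ :=
    exists_first_descent L 0 le_rfl (by simp [SStep.eff] at h0 ⊢; omega)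
  rw [zero_add] at hP0
  refine ⟨P, Q, rfl, ⟨hP, hP0⟩, ?_, ?_⟩
  · simpa [StaysNonneg, SStep.eff, hP0] using ((staysNonneg_append _ _ _).1 hL.2).2.2
  · simpa [SStep.eff, hP0] using h0

lemma arch_unique {P P' Q Q' : List SStep} (h : ℤ) (hP : StaysNonneg h P)
    (h0 : h + endHeight P = 0) (hP' : StaysNonneg h P') (h0' : h + endHeight P' = 0)
    (H : P ++ SStep.D :: Q = P' ++ SStep.D :: Q') : P = P' ∧ Q = Q' := by
  induction P generalizing h P' with
  | nil =>
    cases P' with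
    | nil => simpa using H
    | cons s P' =>
      obtain ⟨rfl, -⟩ : SStep.D = s ∧ _ := by simpa using H
      have := hP'.2.nonneg
      simp [SStep.eff] at this h0
      omega
  | cons s P ih =>
    cases P' with
    | nil =>
      obtain ⟨rfl, -⟩ : s = SStep.D ∧ _ := by simpa using H
      have := hP.2.nonneg
      simp [SStep.eff] at this h0'
      omega
    | cons t P' =>
      obtain ⟨rfl, htail⟩ := List.cons.inj H
      obtain ⟨rfl, rfl⟩ := ih (h + s.eff) hP.2 (by simp at h0; linarith) hP'.2
        (by simp at h0'; linarith) htail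
      exact ⟨rfl, rfl⟩

/-- Pairs of a path without even peaks and a path without odd peaks, of total length `2n - 2`. -/
def IsPeakPair (n : ℕ) (x : List SStep × List SStep) : Prop :=
  pathLength x.1 + pathLength x.2 + 2 = 2 * n ∧
    ((StaysNonneg 0 x.1 ∧ endHeight x.1 = 0) ∧ StaysNonneg 0 x.2 ∧ endHeight x.2 = 0) ∧
    NoPeak Even 0 x.1 ∧ NoPeak Odd 0 x.2

/-- Glue `(P, Q)` to `U P D Q`, with `U D` replaced by `H` when `P` is empty. -/
def joinArch (x : List SStep × List SStep) : List SStep :=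
  if x.1 = [] then SStep.H :: x.2 else SStep.U :: (x.1 ++ SStep.D :: x.2)

/-- Glue `(P, Q)` to `U Q D P`. -/
def joinSwap (x : List SStep × List SStep) : List SStep :=
  SStep.U :: (x.2 ++ SStep.D :: x.1)

lemma bijOn_joinArch (n : ℕ) (hn : 1 ≤ n) :
    Set.BijOn joinArch {x | IsPeakPair n x} {L | IsSchroder L n ∧ NoOddPeak L} := by
  refine ⟨?_, ?_, ?_⟩
  · rintro ⟨P, Q⟩ ⟨hl, ⟨⟨hP, hP0⟩, hQ, hQ0⟩, hPe, hQo⟩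
    simp only at *
    rw [Set.mem_ofPred_eq, isSchroder_iff, noOddPeak_iff]
    by_cases hnil : P = []
    · subst hnil
      simp [joinArch, StaysNonneg, NoPeak, SStep.eff, SStep.len, hQ, hQ0, hQo] at hl ⊢
      omega
    · simp only [joinArch, if_neg hnil]
      refine ⟨⟨?_, ?_, staysNonneg_arch hP hP0 hQ⟩, ?_⟩
      · simp [SStep.len]; omega
      · simp [SStep.eff, hP0, hQ0]
      · rw [noPeak_arch _ _ hP hP0, noPeak_odd_one]
        exact ⟨fun h => absurd h hnil, hPe, hQo⟩
  · rintro ⟨P, Q⟩ ⟨-, ⟨⟨hP, hP0⟩, -⟩, -⟩ ⟨P', Q'⟩ ⟨-, ⟨⟨hP', hP0'⟩, -⟩, -⟩ H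
    simp only [joinArch] at *
    split_ifs at H with h h'
    · simp_all
    · simp at H
    · simp at H
    · obtain ⟨rfl, rfl⟩ := arch_unique 0 hP (by simpa using hP0) hP' (by simpa using hP0')
        (List.cons.inj H).2
      rfl
  · rintro L ⟨hL, hp⟩
    rw [isSchroder_iff] at hL
    rw [noOddPeak_iff] at hp
    obtain ⟨hl, h0, hs⟩ := hL
    rcases L with _ | ⟨_ | _ | _, L⟩
    · simp at hl; omega
    · obtain ⟨P, Q, rfl, ⟨hP, hP0⟩, hQ, hQ0⟩ := exists_arch hs h0
      rw [noPeak_arch _ _ hP hP0, noPeak_odd_one] at hp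
      refine ⟨(P, Q), ⟨?_, ⟨⟨hP, hP0⟩, hQ, hQ0⟩, hp.2.1, hp.2.2⟩, ?_⟩
      · simp [SStep.len] at hl ⊢; omega
      · exact if_neg fun h => hp.1 h odd_one
    · simpa [SStep.eff] using hs.2.nonneg
    · refine ⟨([], L), ⟨?_, ⟨⟨le_rfl, rfl⟩, ?_, ?_⟩, trivial, ?_⟩, if_pos rfl⟩
      · simp [SStep.len] at hl ⊢; omega
      · simpa [SStep.eff] using hs.2
      · simpa [SStep.eff] using h0
      · simpa [SStep.eff] using hp.2

lemma bijOn_joinSwap (n : ℕ) :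
    Set.BijOn joinSwap {x | IsPeakPair n x}
      {L | IsSchroder L n ∧ L[0]? = some SStep.U ∧ NoEvenPeak L} := by
  refine ⟨?_, ?_, ?_⟩
  · rintro ⟨P, Q⟩ ⟨hl, ⟨⟨hP, hP0⟩, hQ, hQ0⟩, hPe, hQo⟩
    simp only [joinSwap] at *
    rw [Set.mem_ofPred_eq, isSchroder_iff, noEvenPeak_iff, noPeak_arch _ _ hQ hQ0,
      noPeak_even_one]
    refine ⟨⟨?_, ?_, staysNonneg_arch hQ hQ0 hP⟩, rfl, fun _ => Int.not_even_one, hQo, hPe⟩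
    · simp [SStep.len]; omega
    · simp [SStep.eff, hP0, hQ0]
  · rintro ⟨P, Q⟩ ⟨-, ⟨-, hQ, hQ0⟩, -⟩ ⟨P', Q'⟩ ⟨-, ⟨-, hQ', hQ0'⟩, -⟩ H
    obtain ⟨h, h'⟩ := arch_unique 0 hQ (by simpa using hQ0) hQ' (by simpa using hQ0')
      (List.cons.inj H).2
    exact Prod.ext h' h
  · rintro L ⟨hL, hU, hp⟩
    rw [isSchroder_iff] at hL
    rw [noEvenPeak_iff] at hp
    obtain ⟨hl, h0, hs⟩ := hL
    rcases L with _ | ⟨s, L⟩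
    · simp at hU
    · obtain rfl : s = SStep.U := by simpa using hU
      obtain ⟨Q, P, rfl, ⟨hQ, hQ0⟩, hP, hP0⟩ := exists_arch hs h0
      rw [noPeak_arch _ _ hQ hQ0, noPeak_even_one] at hp
      refine ⟨(P, Q), ⟨?_, ⟨⟨hP, hP0⟩, hQ, hQ0⟩, hp.2.2, hp.2.1⟩, rfl⟩
      simp [SStep.len] at hl ⊢; omega

/-- For every integer `n ≥ 1`, the number of Schröder paths of length `2n` having no peak
of odd height equals the number of Schröder paths of length `2n` whose first step is `U`
and which have no peak of even height. -/
theorem stmt3 (n : ℕ) (hn : 1 ≤ n) :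
    Nat.card {L : List SStep // IsSchroder L n ∧ NoOddPeak L} =
    Nat.card {L : List SStep // IsSchroder L n ∧ L[0]? = some SStep.U ∧ NoEvenPeak L} :=
  Nat.card_congr (((bijOn_joinArch n hn).equiv _).symm.trans ((bijOn_joinSwap n).equiv _))
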